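/- Let ν = e^f γ with f twice continuously differentiable, where γ is standard Gaussian on ℝⁿ, with finite entropy, finite Fisher information I(ν) = ∫|∇f|²dν, γ-integrable Gaussian width D(ν) of K = {∇f(x)}, and ∫Δf dν finite. Then (1/2) I(ν) ≤ D_KL(ν||γ) − (1/2) ∫ Δf dν + (1/2) D(ν). -/

import Mathlib

open MeasureTheory Real
open scoped RealInnerProductSpace ENNReal

noncomputable def stdGaussian (n : ℕ) : Measure (EuclideanSpace ℝ (Fin n)) :=
  (volume : Measure (EuclideanSpace ℝ (Fin n))).withDensity
    fun x => ENNReal.ofReal ((2 * π) ^ (-(n : ℝ) / 2) * Real.exp (-‖x‖ ^ 2 / 2))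

noncomputable def lap {n : ℕ} (f : EuclideanSpace ℝ (Fin n) → ℝ)
    (x : EuclideanSpace ℝ (Fin n)) : ℝ :=
  ∑ i, fderiv ℝ (fun y => gradient f y) x (EuclideanSpace.single i 1) i

/-- `y ↦ sup_{t ∈ K} ⟨y, t⟩`. -/
noncomputable def gaussWidthFn {n : ℕ} (K : Set (EuclideanSpace ℝ (Fin n)))
    (y : EuclideanSpace ℝ (Fin n)) : ℝ :=
  ⨆ t : K, ⟪y, (t : EuclideanSpace ℝ (Fin n))⟫

def IsCoupling {n : ℕ}
    (p : Measure (EuclideanSpace ℝ (Fin n) × EuclideanSpace ℝ (Fin n)))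
    (ν γ : Measure (EuclideanSpace ℝ (Fin n))) : Prop :=
  p.map Prod.fst = ν ∧ p.map Prod.snd = γ

/-- Squared quadratic Wasserstein distance. -/
noncomputable def W2sq {n : ℕ} (ν γ : Measure (EuclideanSpace ℝ (Fin n))) : ℝ :=
  sInf {r : ℝ | ∃ p, IsCoupling p ν γ ∧ IsProbabilityMeasure p ∧
    r = ∫ q, ‖q.1 - q.2‖ ^ 2 ∂p}

section Gaussian

variable {n : ℕ}

lemma integral_stdGaussian {F : Type*} [NormedAddCommGroup F] [NormedSpace ℝ F]
    (g : EuclideanSpace ℝ (Fin n) → F) :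
    ∫ x, g x ∂(stdGaussian n) =
      ∫ x, ((2 * π) ^ (-(n : ℝ) / 2) * Real.exp (-‖x‖ ^ 2 / 2)) • g x := by
  rw [stdGaussian, integral_withDensity_eq_integral_toReal_smul (by fun_prop)
    (Filter.Eventually.of_forall fun _ => ENNReal.ofReal_lt_top)]
  congr 1 with x
  rw [ENNReal.toReal_ofReal (by positivity)]

lemma integrable_stdGaussian_iff {F : Type*} [NormedAddCommGroup F] [NormedSpace ℝ F]
    {g : EuclideanSpace ℝ (Fin n) → F} :
    Integrable g (stdGaussian n) ↔
      Integrable fun x => ((2 * π) ^ (-(n : ℝ) / 2) * Real.exp (-‖x‖ ^ 2 / 2)) • g x := by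
  rw [stdGaussian, integrable_withDensity_iff_integrable_smul' (by fun_prop)
    (Filter.Eventually.of_forall fun _ => ENNReal.ofReal_lt_top)]
  congr! 2 with x
  rw [ENNReal.toReal_ofReal (by positivity)]

lemma integral_rexp_neg_norm_sq_div_two :
    ∫ x : EuclideanSpace ℝ (Fin n), Real.exp (-‖x‖ ^ 2 / 2) = (2 * π) ^ ((n : ℝ) / 2) := by
  have h := GaussianFourier.integral_rexp_neg_mul_sq_norm (V := EuclideanSpace ℝ (Fin n))
    (b := 1 / 2) (by norm_num)
  simp only [finrank_euclideanSpace, Fintype.card_fin] at h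
  rw [show 2 * π = π / (1 / 2) by ring, ← h]
  congr 1 with x
  congr 1
  ring

lemma integrable_rexp_neg_mul_norm_sq {b : ℝ} (hb : 0 < b) :
    Integrable fun x : EuclideanSpace ℝ (Fin n) => Real.exp (-b * ‖x‖ ^ 2) := by
  have h := (GaussianFourier.integrable_cexp_neg_mul_sq_norm_add
    (V := EuclideanSpace ℝ (Fin n)) (b := b) (by simpa using hb) 0 0).re
  refine h.congr (Filter.Eventually.of_forall fun x => ?_)
  simp only [zero_mul, add_zero]
  norm_cast

lemma stdGaussian_const_mul :
    (2 * π) ^ (-(n : ℝ) / 2) * (2 * π) ^ ((n : ℝ) / 2) = 1 := by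
  rw [← Real.rpow_add (by positivity)]
  ring_nf
  simp

instance isProbabilityMeasure_stdGaussian : IsProbabilityMeasure (stdGaussian n) := by
  constructor
  have hinteg : Integrable fun x : EuclideanSpace ℝ (Fin n) =>
      (2 * π) ^ (-(n : ℝ) / 2) * Real.exp (-‖x‖ ^ 2 / 2) := by
    refine ((integrable_rexp_neg_mul_norm_sq (b := 1 / 2) (by norm_num)).congr
      (Filter.Eventually.of_forall fun x => ?_)).const_mul _
    simp only []
    congr 1
    ring
  rw [stdGaussian, withDensity_apply _ MeasurableSet.univ, Measure.restrict_univ,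
    ← ofReal_integral_eq_lintegral_ofReal hinteg
      (Filter.Eventually.of_forall fun _ => by positivity),
    integral_const_mul, integral_rexp_neg_norm_sq_div_two, stdGaussian_const_mul,
    ENNReal.ofReal_one]

lemma integrable_exp_mul_norm_stdGaussian (c : ℝ) :
    Integrable (fun x => Real.exp (c * ‖x‖)) (stdGaussian n) := by
  rw [integrable_stdGaussian_iff]
  refine Integrable.mono' (((integrable_rexp_neg_mul_norm_sq (n := n) (b := 1 / 4)
    (by norm_num)).const_mul (Real.exp (c ^ 2))).const_mul ((2 * π) ^ (-(n : ℝ) / 2)))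
    (by fun_prop) (Filter.Eventually.of_forall fun x => ?_)
  rw [smul_eq_mul, Real.norm_of_nonneg (by positivity), mul_assoc, ← Real.exp_add, ← Real.exp_add]
  refine mul_le_mul_of_nonneg_left (Real.exp_le_exp.2 ?_) (by positivity)
  nlinarith [sq_nonneg (c - ‖x‖ / 2)]

lemma charFun_stdGaussian' (t : EuclideanSpace ℝ (Fin n)) :
    charFun (stdGaussian n) t = Complex.exp (-(‖t‖ : ℂ) ^ 2 / 2) := by
  rw [charFun_apply, integral_stdGaussian]
  have h := GaussianFourier.integral_cexp_neg_mul_sq_norm_add (V := EuclideanSpace ℝ (Fin n))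
    (b := 1 / 2) (by norm_num) Complex.I t
  have h' : ∀ x : EuclideanSpace ℝ (Fin n),
      ((2 * π) ^ (-(n : ℝ) / 2) * Real.exp (-‖x‖ ^ 2 / 2)) •
        Complex.exp ((⟪x, t⟫ : ℝ) * Complex.I) =
      (((2 * π) ^ (-(n : ℝ) / 2) : ℝ) : ℂ) *
        Complex.exp (-(1 / 2) * (‖x‖ : ℂ) ^ 2 + Complex.I * (⟪t, x⟫ : ℝ)) := by
    intro x
    rw [Complex.real_smul, Complex.ofReal_mul, Complex.ofReal_exp, mul_assoc, ← Complex.exp_add,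
      real_inner_comm]
    push_cast
    ring_nf
  simp_rw [h']
  rw [integral_const_mul, h]
  have hpi : ((π : ℂ) / (1 / 2)) ^ (((Module.finrank ℝ (EuclideanSpace ℝ (Fin n)) : ℕ) : ℂ) / 2)
      = (((2 * π) ^ ((n : ℝ) / 2) : ℝ) : ℂ) := by
    rw [Complex.ofReal_cpow (by positivity)]
    simp
    ring_nf
  rw [hpi, ← mul_assoc, ← Complex.ofReal_mul, stdGaussian_const_mul]
  simp
  ring_nf

/-- The Cameron–Martin formula. -/
lemma integral_stdGaussian_add (g : EuclideanSpace ℝ (Fin n) → ℝ)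
    (q : EuclideanSpace ℝ (Fin n)) :
    ∫ y, g (y + q) ∂(stdGaussian n) =
      ∫ y, Real.exp (⟪q, y⟫ - ‖q‖ ^ 2 / 2) * g y ∂(stdGaussian n) := by
  rw [integral_stdGaussian, integral_stdGaussian, ← integral_sub_right_eq_self _ q]
  congr 1 with y
  rw [sub_add_cancel, smul_eq_mul, smul_eq_mul, mul_assoc, mul_assoc, ← mul_assoc (Real.exp _),
    ← Real.exp_add]
  congr 3
  rw [norm_sub_sq_real, real_inner_comm]
  ring

lemma integral_inner_stdGaussian (p : EuclideanSpace ℝ (Fin n)) :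
    ∫ y, ⟪p, y⟫ ∂(stdGaussian n) = 0 := by
  have h : ∫ y, ⟪p, y⟫ ∂(stdGaussian n) = - ∫ y, ⟪p, y⟫ ∂(stdGaussian n) := by
    rw [integral_stdGaussian]
    conv_lhs => rw [← integral_neg_eq_self]
    simp [integral_neg]
  linarith

lemma map_smul_conv_map_smul_stdGaussian (a b : ℝ) :
    ((stdGaussian n).map (fun x => a • x)) ∗ ((stdGaussian n).map (fun x => b • x)) =
      (stdGaussian n).map (fun x => √(a ^ 2 + b ^ 2) • x) := by
  have h : ∀ c : ℝ, IsProbabilityMeasure ((stdGaussian n).map (fun x => c • x)) := fun c =>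
    Measure.isProbabilityMeasure_map (by fun_prop)
  have := h a
  have := h b
  have := h (√(a ^ 2 + b ^ 2))
  refine Measure.ext_of_charFun ?_
  ext t
  rw [charFun_conv, charFun_map_smul, charFun_map_smul, charFun_map_smul, charFun_stdGaussian',
    charFun_stdGaussian', charFun_stdGaussian', ← Complex.exp_add]
  congr 1
  simp only [norm_smul, Real.norm_eq_abs, Complex.ofReal_mul, mul_pow]
  norm_cast
  rw [sq_abs, sq_abs, sq_abs, Real.sq_sqrt (by positivity)]
  ring_nf

lemma integral_integral_stdGaussian {φ : EuclideanSpace ℝ (Fin n) → ℝ} (hφ : Continuous φ)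
    (a b : ℝ) (x : EuclideanSpace ℝ (Fin n))
    (hinteg : Integrable (fun y => φ (x + √(a ^ 2 + b ^ 2) • y)) (stdGaussian n)) :
    ∫ y, ∫ z, φ (x + a • y + b • z) ∂(stdGaussian n) ∂(stdGaussian n) =
      ∫ y, φ (x + √(a ^ 2 + b ^ 2) • y) ∂(stdGaussian n) := by
  have h : ∀ c : ℝ, IsProbabilityMeasure ((stdGaussian n).map (fun x => c • x)) := fun c =>
    Measure.isProbabilityMeasure_map (by fun_prop)
  have := h a
  have := h b
  have hi : Integrable (fun y => φ (x + y))
      (((stdGaussian n).map (fun x => a • x)) ∗ ((stdGaussian n).map (fun x => b • x))) := by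
    rw [map_smul_conv_map_smul_stdGaussian]
    exact (integrable_map_measure (by fun_prop) (by fun_prop)).2 hinteg
  have h1 := integral_conv hi
  rw [map_smul_conv_map_smul_stdGaussian, integral_map (by fun_prop) (by fun_prop)] at h1
  rw [h1, integral_map (by fun_prop)]
  · congr 1 with y
    rw [integral_map (by fun_prop) (by fun_prop)]
    simp only [add_assoc]
  · refine StronglyMeasurable.aestronglyMeasurable ?_
    have hc : Continuous fun p : EuclideanSpace ℝ (Fin n) × EuclideanSpace ℝ (Fin n) =>
        φ (x + (p.1 + p.2)) := by fun_prop
    exact hc.stronglyMeasurable.integral_prod_right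

end Gaussian

section LogHeat

open scoped NNReal

variable {n : ℕ}

/-- The Gaussian average `E g(x + a Y)`. -/
noncomputable def gaussAvg (g : EuclideanSpace ℝ (Fin n) → ℝ) (a : ℝ)
    (x : EuclideanSpace ℝ (Fin n)) : ℝ :=
  ∫ y, g (x + a • y) ∂(stdGaussian n)

/-- The logarithm of the Gaussian average of `exp g`. -/
noncomputable def logGaussAvg (g : EuclideanSpace ℝ (Fin n) → ℝ) (a : ℝ)
    (x : EuclideanSpace ℝ (Fin n)) : ℝ :=
  Real.log (∫ y, Real.exp (g (x + a • y)) ∂(stdGaussian n))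

/-- Jensen's inequality for the exponential. -/
lemma integral_le_log_integral_exp {α : Type*} {mα : MeasurableSpace α} {μ : Measure α}
    [IsProbabilityMeasure μ] {X : α → ℝ} (hX : Integrable X μ)
    (hexp : Integrable (fun a => Real.exp (X a)) μ) :
    ∫ a, X a ∂μ ≤ Real.log (∫ a, Real.exp (X a) ∂μ) := by
  rw [Real.le_log_iff_exp_le (integral_exp_pos hexp)]
  exact convexOn_exp.map_integral_le Real.continuous_exp.continuousOn isClosed_univ
    (Filter.Eventually.of_forall fun _ => Set.mem_univ _) hX hexp

lemma LipschitzWith.le_add_mul_norm {K : ℝ≥0} {g : EuclideanSpace ℝ (Fin n) → ℝ}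
    (hg : LipschitzWith K g) (x z : EuclideanSpace ℝ (Fin n)) :
    |g (x + z) - g x| ≤ K * ‖z‖ := by
  simpa [Real.dist_eq] using hg.dist_le_mul (x + z) x

lemma LipschitzWith.integrable_stdGaussian {K : ℝ≥0} {g : EuclideanSpace ℝ (Fin n) → ℝ}
    (hg : LipschitzWith K g) (a : ℝ) (x : EuclideanSpace ℝ (Fin n)) :
    Integrable (fun y => g (x + a • y)) (stdGaussian n) := by
  have hc := hg.continuous
  refine Integrable.mono' ((integrable_const |g x|).add
    (integrable_exp_mul_norm_stdGaussian (K * |a|))) (by fun_prop)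
    (Filter.Eventually.of_forall fun y => ?_)
  have h1 := hg.le_add_mul_norm x (a • y)
  rw [norm_smul, Real.norm_eq_abs, ← mul_assoc] at h1
  have h2 := Real.add_one_le_exp (K * |a| * ‖y‖)
  have h3 := abs_sub_abs_le_abs_sub (g (x + a • y)) (g x)
  simp only [Pi.add_apply, Real.norm_eq_abs]
  linarith

lemma LipschitzWith.integrable_exp_stdGaussian {K : ℝ≥0} {g : EuclideanSpace ℝ (Fin n) → ℝ}
    (hg : LipschitzWith K g) (a : ℝ) (x : EuclideanSpace ℝ (Fin n)) :
    Integrable (fun y => Real.exp (g (x + a • y))) (stdGaussian n) := by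
  have hc := hg.continuous
  refine Integrable.mono' ((integrable_exp_mul_norm_stdGaussian (K * |a|)).const_mul
    (Real.exp (g x))) (by fun_prop)
    (Filter.Eventually.of_forall fun y => ?_)
  have h1 := hg.le_add_mul_norm x (a • y)
  rw [norm_smul, Real.norm_eq_abs, ← mul_assoc] at h1
  rw [Real.norm_of_nonneg (Real.exp_pos _).le, ← Real.exp_add]
  refine Real.exp_le_exp.2 ?_
  linarith [le_abs_self (g (x + a • y) - g x)]

lemma LipschitzWith.integral_exp_pos {K : ℝ≥0} {g : EuclideanSpace ℝ (Fin n) → ℝ}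
    (hg : LipschitzWith K g) (a : ℝ) (x : EuclideanSpace ℝ (Fin n)) :
    0 < ∫ y, Real.exp (g (x + a • y)) ∂(stdGaussian n) :=
  MeasureTheory.integral_exp_pos (hg.integrable_exp_stdGaussian a x)

lemma LipschitzWith.exp_logGaussAvg {K : ℝ≥0} {g : EuclideanSpace ℝ (Fin n) → ℝ}
    (hg : LipschitzWith K g) (a : ℝ) (x : EuclideanSpace ℝ (Fin n)) :
    Real.exp (logGaussAvg g a x) = ∫ y, Real.exp (g (x + a • y)) ∂(stdGaussian n) :=
  Real.exp_log (hg.integral_exp_pos a x)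

lemma LipschitzWith.gaussAvg {K : ℝ≥0} {g : EuclideanSpace ℝ (Fin n) → ℝ}
    (hg : LipschitzWith K g) (a : ℝ) : LipschitzWith K (gaussAvg g a) := by
  refine LipschitzWith.of_le_add_mul K fun x x' => ?_
  have h : ∫ y, g (x + a • y) ∂(stdGaussian n) ≤
      ∫ y, (g (x' + a • y) + K * dist x x') ∂(stdGaussian n) := by
    refine integral_mono (hg.integrable_stdGaussian a x)
      ((hg.integrable_stdGaussian a x').add (integrable_const _)) fun y => ?_
    have := hg.le_add_mul (x + a • y) (x' + a • y)
    rwa [dist_add_right] at this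
  rw [integral_add (hg.integrable_stdGaussian a x') (integrable_const _)] at h
  simpa [_root_.gaussAvg] using h

lemma LipschitzWith.logGaussAvg {K : ℝ≥0} {g : EuclideanSpace ℝ (Fin n) → ℝ}
    (hg : LipschitzWith K g) (a : ℝ) : LipschitzWith K (logGaussAvg g a) := by
  refine LipschitzWith.of_le_add_mul K fun x x' => ?_
  have h : ∫ y, Real.exp (g (x + a • y)) ∂(stdGaussian n) ≤
      ∫ y, Real.exp (g (x' + a • y)) * Real.exp (K * dist x x') ∂(stdGaussian n) := by
    refine integral_mono (hg.integrable_exp_stdGaussian a x)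
      ((hg.integrable_exp_stdGaussian a x').mul_const _) fun y => ?_
    simp only []
    rw [← Real.exp_add]
    have := hg.le_add_mul (x + a • y) (x' + a • y)
    rw [dist_add_right] at this
    exact Real.exp_le_exp.2 this
  rw [integral_mul_const, ← hg.exp_logGaussAvg, ← hg.exp_logGaussAvg, ← Real.exp_add] at h
  exact Real.exp_le_exp.1 h

lemma LipschitzWith.gaussAvg_gaussAvg {K : ℝ≥0} {g : EuclideanSpace ℝ (Fin n) → ℝ}
    (hg : LipschitzWith K g) (a b : ℝ) (x : EuclideanSpace ℝ (Fin n)) :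
    ∫ y, _root_.gaussAvg g a (x + b • y) ∂(stdGaussian n) =
      _root_.gaussAvg g (√(a ^ 2 + b ^ 2)) x := by
  rw [add_comm (a ^ 2)]
  exact integral_integral_stdGaussian hg.continuous b a x (hg.integrable_stdGaussian _ x)

lemma LipschitzWith.logGaussAvg_logGaussAvg {K : ℝ≥0} {g : EuclideanSpace ℝ (Fin n) → ℝ}
    (hg : LipschitzWith K g) (a b : ℝ) (x : EuclideanSpace ℝ (Fin n)) :
    Real.log (∫ y, Real.exp (_root_.logGaussAvg g a (x + b • y)) ∂(stdGaussian n)) =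
      _root_.logGaussAvg g (√(a ^ 2 + b ^ 2)) x := by
  have hc := hg.continuous
  simp_rw [hg.exp_logGaussAvg]
  rw [add_comm (a ^ 2)]
  exact congrArg Real.log (integral_integral_stdGaussian (φ := fun z => Real.exp (g z))
    (by fun_prop) b a x (hg.integrable_exp_stdGaussian _ x))

lemma integrable_inner_stdGaussian (q : EuclideanSpace ℝ (Fin n)) :
    Integrable (fun y => ⟪q, y⟫) (stdGaussian n) := by
  have : LipschitzWith ‖q‖₊ (fun y : EuclideanSpace ℝ (Fin n) => ⟪q, y⟫) := by
    have h := (innerSL ℝ q).lipschitz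
    rw [show ‖q‖₊ = ‖innerSL ℝ q‖₊ from NNReal.eq (by simp)]
    simpa using h
  simpa using this.integrable_stdGaussian 1 0

/-- The Gaussian variational lower bound for log-Laplace transforms, for constant shifts. -/
lemma LipschitzWith.integral_shift_sub_le_log {K : ℝ≥0} {g : EuclideanSpace ℝ (Fin n) → ℝ}
    (hg : LipschitzWith K g) (a : ℝ) (x q : EuclideanSpace ℝ (Fin n)) :
    ∫ y, g (x + a • y + a • q) ∂(stdGaussian n) - ‖q‖ ^ 2 / 2 ≤
      Real.log (∫ y, Real.exp (g (x + a • y)) ∂(stdGaussian n)) := by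
  have hc := hg.continuous
  have hq := integrable_inner_stdGaussian q
  have hgq : Integrable (fun y => g (x + a • y + a • q)) (stdGaussian n) := by
    simpa only [add_right_comm] using hg.integrable_stdGaussian a (x + a • q)
  have hcm := integral_stdGaussian_add
    (fun y => Real.exp (g (x + a • y) - ⟪q, y⟫ + ‖q‖ ^ 2 / 2)) q
  have hcm' : ∫ y, Real.exp (g (x + a • y + a • q) - ⟪q, y⟫ - ‖q‖ ^ 2 / 2) ∂(stdGaussian n)
      = ∫ y, Real.exp (g (x + a • y)) ∂(stdGaussian n) := by
    convert hcm using 1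
    · congr 1 with y
      rw [smul_add, inner_add_right, real_inner_self_eq_norm_sq, ← add_assoc]
      ring_nf
    · congr 1 with y
      rw [← Real.exp_add]
      ring_nf
  have hinteg : Integrable
      (fun y => g (x + a • y + a • q) - ⟪q, y⟫ - ‖q‖ ^ 2 / 2) (stdGaussian n) :=
    (hgq.sub hq).sub (integrable_const _)
  have hexp : Integrable (fun y => Real.exp (g (x + a • y + a • q) - ⟪q, y⟫ - ‖q‖ ^ 2 / 2))
      (stdGaussian n) := by
    refine Integrable.of_integral_ne_zero ?_
    rw [hcm']
    exact (hg.integral_exp_pos a x).ne'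
  have hj := integral_le_log_integral_exp hinteg hexp
  have hsplit : ∫ y, (g (x + a • y + a • q) - ⟪q, y⟫ - ‖q‖ ^ 2 / 2) ∂(stdGaussian n) =
      ∫ y, g (x + a • y + a • q) ∂(stdGaussian n) - ‖q‖ ^ 2 / 2 := by
    rw [integral_sub (f := fun y => g (x + a • y + a • q) - ⟪q, y⟫) (hgq.sub hq)
      (integrable_const _), integral_sub hgq hq, integral_inner_stdGaussian]
    simp
  rwa [hcm', hsplit] at hj

lemma Real.exp_le_one_add_add_sq_mul_exp_abs (t : ℝ) :
    Real.exp t ≤ 1 + t + t ^ 2 * Real.exp |t| := by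
  have h := Complex.norm_exp_sub_sum_le_norm_mul_exp t 2
  simp only [Finset.sum_range_succ, Finset.range_zero, Finset.sum_empty, pow_zero, pow_one,
    Nat.factorial_zero, Nat.factorial_one, Nat.cast_one, div_one, zero_add] at h
  rw [← Complex.ofReal_exp, ← Complex.ofReal_one, ← Complex.ofReal_add, ← Complex.ofReal_sub,
    Complex.norm_real, Complex.norm_real, Real.norm_eq_abs, Real.norm_eq_abs, sq_abs] at h
  linarith [le_abs_self (Real.exp t - (1 + t))]


lemma Real.sq_mul_exp_abs_le {K M h t u : ℝ} (hu : 0 ≤ u) (h1 : |t| ≤ M * (h * u ^ 2))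
    (h2 : |t| ≤ 2 * K * u) :
    t ^ 2 * Real.exp |t| ≤ 24 * M ^ 2 * h ^ 2 * Real.exp ((2 * K + 1) * u) := by
  have h3 : t ^ 2 ≤ (M * (h * u ^ 2)) ^ 2 := by
    rw [← sq_abs t]
    gcongr
  have h4 : u ^ 4 ≤ 24 * Real.exp u := by
    have := Real.pow_div_factorial_le_exp u hu 4
    rw [div_le_iff₀ (by positivity)] at this
    norm_num [Nat.factorial] at this
    linarith
  calc t ^ 2 * Real.exp |t| ≤ (M * (h * u ^ 2)) ^ 2 * Real.exp (2 * K * u) := by gcongr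
    _ = M ^ 2 * h ^ 2 * (u ^ 4 * Real.exp (2 * K * u)) := by ring
    _ ≤ M ^ 2 * h ^ 2 * (24 * Real.exp u * Real.exp (2 * K * u)) := by gcongr
    _ = 24 * M ^ 2 * h ^ 2 * Real.exp ((2 * K + 1) * u) := by
      rw [mul_assoc 24, ← Real.exp_add]
      ring_nf

/-- A small-time converse of the Gaussian variational lower bound: the shift by the gradient
is optimal up to second order. -/
lemma LipschitzWith.log_le_integral_shift_add {K : ℝ≥0} {g : EuclideanSpace ℝ (Fin n) → ℝ}
    (hg : LipschitzWith K g) {M h : ℝ} (h0 : 0 ≤ h) (h1 : h ≤ 1)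
    (x p : EuclideanSpace ℝ (Fin n)) (hp : ‖p‖ ≤ K)
    (hS : ∀ z, |g (x + z) - g x - ⟪p, z⟫| ≤ M * ‖z‖ ^ 2) :
    Real.log (∫ y, Real.exp (g (x + √h • y)) ∂(stdGaussian n)) ≤
      ∫ y, g (x + √h • y + h • p) ∂(stdGaussian n) - h * ‖p‖ ^ 2 / 2 +
        24 * M ^ 2 * (∫ y, Real.exp ((2 * K + 1) * (‖y‖ + K)) ∂(stdGaussian n)) * h ^ 2 := by
  have hc := hg.continuous
  have hsq : √h * √h = h := Real.mul_self_sqrt h0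
  have hs1 : √h ≤ 1 := Real.sqrt_le_one.2 h1
  have hs0 : 0 ≤ √h := Real.sqrt_nonneg h
  set ρ : EuclideanSpace ℝ (Fin n) → ℝ := fun y =>
    g (x + √h • y + h • p) - g x - √h * ⟪p, y⟫ - h * ‖p‖ ^ 2 with hρ
  have hgi : Integrable (fun y => g (x + √h • y + h • p)) (stdGaussian n) := by
    simpa only [add_right_comm] using hg.integrable_stdGaussian √h (x + h • p)
  have hpi := (integrable_inner_stdGaussian p).const_mul √h
  have hρi : Integrable ρ (stdGaussian n) :=
    ((hgi.sub (integrable_const _)).sub hpi).sub (integrable_const _)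
  have hρint : ∫ y, ρ y ∂(stdGaussian n) =
      ∫ y, g (x + √h • y + h • p) ∂(stdGaussian n) - g x - h * ‖p‖ ^ 2 := by
    rw [hρ, integral_sub (f := fun y => g (x + √h • y + h • p) - g x - √h * ⟪p, y⟫)
      ((hgi.sub (integrable_const _)).sub hpi) (integrable_const _),
      integral_sub (f := fun y => g (x + √h • y + h • p) - g x)
      (hgi.sub (integrable_const _)) hpi, integral_sub hgi (integrable_const _),
      integral_const_mul, integral_inner_stdGaussian]
    simp
  have hρz : ∀ y, ρ y = g (x + √h • (y + √h • p)) - g x - ⟪p, √h • (y + √h • p)⟫ := by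
    intro y
    simp only [hρ, smul_add, smul_smul, hsq, inner_add_right, real_inner_smul_right,
      real_inner_self_eq_norm_sq, add_assoc]
    ring
  have hnorm : ∀ y : EuclideanSpace ℝ (Fin n), ‖√h • (y + √h • p)‖ ≤ √h * (‖y‖ + K) := by
    intro y
    rw [norm_smul, Real.norm_of_nonneg hs0]
    gcongr
    refine (norm_add_le _ _).trans ?_
    rw [norm_smul, Real.norm_of_nonneg hs0]
    gcongr
    nlinarith [norm_nonneg p]
  have hM : ∀ y, |ρ y| ≤ |M| * (h * (‖y‖ + K) ^ 2) := by
    intro y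
    rw [hρz]
    refine (hS _).trans ?_
    calc M * ‖√h • (y + √h • p)‖ ^ 2 ≤ |M| * (√h * (‖y‖ + K)) ^ 2 := by
          gcongr
          · exact le_abs_self M
          · exact hnorm y
      _ = |M| * (h * (‖y‖ + K) ^ 2) := by
          rw [mul_pow, Real.sq_sqrt h0]
  have hK : ∀ y, |ρ y| ≤ 2 * K * (‖y‖ + K) := by
    intro y
    rw [hρz]
    have e1 := hg.le_add_mul_norm x (√h • (y + √h • p))
    have e2 := abs_real_inner_le_norm p (√h • (y + √h • p))
    have e3 := abs_sub (g (x + √h • (y + √h • p)) - g x) (⟪p, √h • (y + √h • p)⟫)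
    have e4 : ‖√h • (y + √h • p)‖ ≤ ‖y‖ + K :=
      (hnorm y).trans (mul_le_of_le_one_left (by positivity) hs1)
    have e5 : ‖p‖ * ‖√h • (y + √h • p)‖ ≤ K * (‖y‖ + K) := by gcongr
    have e6 : (K : ℝ) * ‖√h • (y + √h • p)‖ ≤ K * (‖y‖ + K) := by gcongr
    linarith
  have hmain : ∀ y, Real.exp (ρ y) ≤
      1 + ρ y + 24 * M ^ 2 * h ^ 2 * Real.exp ((2 * K + 1) * (‖y‖ + K)) := by
    intro y
    have := Real.sq_mul_exp_abs_le (by positivity) (hM y) (hK y)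
    rw [sq_abs] at this
    linarith [Real.exp_le_one_add_add_sq_mul_exp_abs (ρ y)]
  have hEi : Integrable (fun y : EuclideanSpace ℝ (Fin n) =>
      Real.exp ((2 * K + 1) * (‖y‖ + K))) (stdGaussian n) := by
    simp_rw [mul_add, Real.exp_add]
    exact (integrable_exp_mul_norm_stdGaussian _).mul_const _
  have hcm := integral_stdGaussian_add
    (fun y => Real.exp (g (x + √h • y) - g x - ⟪p, √h • y⟫)) (√h • p)
  have hcm' : ∫ y, Real.exp (g (x + √h • y)) ∂(stdGaussian n) =
      Real.exp (g x + h * ‖p‖ ^ 2 / 2) * ∫ y, Real.exp (ρ y) ∂(stdGaussian n) := by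
    simp_rw [hρz]
    rw [hcm, ← integral_const_mul]
    congr 1 with y
    rw [← Real.exp_add, ← Real.exp_add, norm_smul, mul_pow, Real.norm_of_nonneg hs0,
      Real.sq_sqrt h0, real_inner_smul_left, real_inner_smul_right]
    ring_nf
  have hρpos : 0 < ∫ y, Real.exp (ρ y) ∂(stdGaussian n) := by
    have := hg.integral_exp_pos √h x
    rw [hcm'] at this
    exact pos_of_mul_pos_right this (Real.exp_pos _).le
  have hle : ∫ y, Real.exp (ρ y) ∂(stdGaussian n) ≤ 1 + ∫ y, ρ y ∂(stdGaussian n) +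
      24 * M ^ 2 * h ^ 2 * ∫ y, Real.exp ((2 * K + 1) * (‖y‖ + K)) ∂(stdGaussian n) := by
    refine (integral_mono (Integrable.of_integral_ne_zero hρpos.ne')
      (((integrable_const 1).add hρi).add (hEi.const_mul _)) hmain).trans_eq ?_
    rw [integral_add' ((integrable_const 1).add hρi) (hEi.const_mul _),
      integral_add' (integrable_const 1) hρi, integral_const_mul]
    simp
  rw [hcm', Real.log_mul (Real.exp_pos _).ne' hρpos.ne', Real.log_exp]
  have := Real.log_le_sub_one_of_pos hρpos
  linarith

/-- First-order expansion of `logGaussAvg F`, with a constant independent of the noise level. -/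
lemma exists_abs_logGaussAvg_sub_le {K : ℝ≥0} {F : EuclideanSpace ℝ (Fin n) → ℝ}
    (hF : LipschitzWith K F) {M : ℝ} {D : EuclideanSpace ℝ (Fin n) → EuclideanSpace ℝ (Fin n)}
    (hD : Continuous D) (hDK : ∀ x, ‖D x‖ ≤ K)
    (hS : ∀ x z, |F (x + z) - F x - ⟪D x, z⟫| ≤ M * ‖z‖ ^ 2)
    (a : ℝ) (x : EuclideanSpace ℝ (Fin n)) :
    ∃ p, ‖p‖ ≤ K ∧ ∀ z, |logGaussAvg F a (x + z) - logGaussAvg F a x - ⟪p, z⟫| ≤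
      (M + K ^ 2 / 2) * ‖z‖ ^ 2 := by
  have hc := hF.continuous
  set Q := (stdGaussian n).tilted fun y => F (x + a • y) with hQ
  have hQp : IsProbabilityMeasure Q :=
    isProbabilityMeasure_tilted (hF.integrable_exp_stdGaussian a x)
  have hDi : Integrable (fun y => D (x + a • y)) Q :=
    Integrable.of_bound (by fun_prop) K (Filter.Eventually.of_forall fun y => hDK _)
  refine ⟨∫ y, D (x + a • y) ∂Q, ?_, fun z => ?_⟩
  · simpa using norm_integral_le_of_norm_le_const (μ := Q)
      (Filter.Eventually.of_forall fun y => hDK (x + a • y))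
  set X : EuclideanSpace ℝ (Fin n) → ℝ := fun y => F (x + z + a • y) - F (x + a • y) with hX
  have hXc : Continuous X := by fun_prop
  have hXb : ∀ y, |X y| ≤ K * ‖z‖ := by
    intro y
    have := hF.le_add_mul_norm (x + a • y) z
    rwa [add_right_comm] at this
  have hXi : Integrable X Q :=
    Integrable.of_bound hXc.aestronglyMeasurable (K * ‖z‖)
      (Filter.Eventually.of_forall fun y => hXb y)
  have hXe : Integrable (fun y => Real.exp (X y)) Q :=
    Integrable.of_bound (by fun_prop) (Real.exp (K * ‖z‖))
      (Filter.Eventually.of_forall fun y => by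
        rw [Real.norm_of_nonneg (Real.exp_pos _).le]
        exact Real.exp_le_exp.2 ((le_abs_self _).trans (hXb y)))
  have hlog : logGaussAvg F a (x + z) - logGaussAvg F a x =
      Real.log (∫ y, Real.exp (X y) ∂Q) := by
    rw [logGaussAvg, logGaussAvg, ← Real.log_div (hF.integral_exp_pos a _).ne'
      (hF.integral_exp_pos a _).ne', hQ, integral_tilted, ← integral_div]
    congr 2 with y
    rw [smul_eq_mul, div_mul_eq_mul_div, ← Real.exp_add]
    simp [hX]
  have hlow := integral_le_log_integral_exp hXi hXe
  have hup : Real.log (∫ y, Real.exp (X y) ∂Q) ≤ ∫ y, X y ∂Q + (K * ‖z‖) ^ 2 / 2 := by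
    have hsub := ProbabilityTheory.hasSubgaussianMGF_of_mem_Icc (μ := Q) (X := X)
      (a := -(K * ‖z‖)) (b := K * ‖z‖) hXc.aemeasurable
      (Filter.Eventually.of_forall fun y => abs_le.1 (hXb y))
    have hm := hsub.mgf_le 1
    have hm' : Real.exp (-∫ y, X y ∂Q) * ∫ y, Real.exp (X y) ∂Q ≤
        Real.exp ((K * ‖z‖) ^ 2 / 2) := by
      rw [← integral_const_mul]
      convert hm using 1
      · rw [ProbabilityTheory.mgf]
        congr 1 with y
        rw [← Real.exp_add]
        ring_nf
      · congr 1
        have hKz : 0 ≤ (K : ℝ) * ‖z‖ := by positivity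
        push_cast
        rw [Real.norm_of_nonneg (by linarith)]
        ring
    rw [Real.log_le_iff_le_exp (integral_exp_pos hXe), Real.exp_add]
    rwa [Real.exp_neg, inv_mul_le_iff₀ (Real.exp_pos _)] at hm'
  have hip : ⟪∫ y, D (x + a • y) ∂Q, z⟫ = ∫ y, ⟪D (x + a • y), z⟫ ∂Q := by
    rw [real_inner_comm, ← integral_inner hDi]
    simp_rw [real_inner_comm z]
  have hdi : Integrable (fun y => ⟪D (x + a • y), z⟫) Q := hDi.inner_const z
  have hmid : |∫ y, X y ∂Q - ∫ y, ⟪D (x + a • y), z⟫ ∂Q| ≤ M * ‖z‖ ^ 2 := by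
    rw [← integral_sub hXi hdi]
    have := norm_integral_le_of_norm_le_const (μ := Q) (C := M * ‖z‖ ^ 2)
      (f := fun y => X y - ⟪D (x + a • y), z⟫)
      (Filter.Eventually.of_forall fun y => by
        have := hS (x + a • y) z
        rwa [add_right_comm] at this)
    simpa using this
  rw [hlog, hip]
  rw [abs_le] at hmid ⊢
  constructor <;> nlinarith [sq_nonneg (K * ‖z‖ : ℝ)]

end LogHeat

section StaticInequality

open scoped NNReal Convolution

variable {n : ℕ}

lemma logGaussAvg_zero (g : EuclideanSpace ℝ (Fin n) → ℝ) (x : EuclideanSpace ℝ (Fin n)) :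
    logGaussAvg g 0 x = g x := by
  simp [logGaussAvg]

lemma gaussAvg_zero (g : EuclideanSpace ℝ (Fin n) → ℝ) (x : EuclideanSpace ℝ (Fin n)) :
    gaussAvg g 0 x = g x := by
  simp [gaussAvg]

lemma logGaussAvg_discrete_le {K K' Kw : ℝ≥0} {F G w : EuclideanSpace ℝ (Fin n) → ℝ}
    (hF : LipschitzWith K F) (hG : LipschitzWith K' G) (hw : LipschitzWith Kw w) {M s h : ℝ}
    (hs : 0 < s) (h0 : 0 ≤ h) (h1 : h ≤ 1)
    (hS : ∀ a x, ∃ p, ‖p‖ ≤ K ∧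
      ∀ z, |logGaussAvg F a (x + z) - logGaussAvg F a x - ⟪p, z⟫| ≤ M * ‖z‖ ^ 2)
    (hFG : ∀ b u, F (b + u) ≤ s⁻¹ ^ 2 * G (b + s • u) + w b) (k : ℕ) :
    ∀ b u, logGaussAvg F √(k * h) (b + u) ≤
      s⁻¹ ^ 2 * logGaussAvg G √(k * h) (b + s • u) + gaussAvg w √(k * h) b +
        k * (24 * M ^ 2 * (∫ y, Real.exp ((2 * K + 1) * (‖y‖ + K)) ∂(stdGaussian n)) * h ^ 2) := by
  set C := 24 * M ^ 2 * (∫ y, Real.exp ((2 * K + 1) * (‖y‖ + K)) ∂(stdGaussian n)) * h ^ 2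
  induction k with
  | zero =>
    intro b u
    simpa [logGaussAvg_zero, gaussAvg_zero] using hFG b u
  | succ k ih =>
    intro b u
    have hsq : √((k + 1 : ℕ) * h) = √(√(k * h) ^ 2 + √h ^ 2) := by
      rw [Real.sq_sqrt (by positivity), Real.sq_sqrt h0]
      push_cast
      ring_nf
    rw [hsq, ← hF.logGaussAvg_logGaussAvg, ← hG.logGaussAvg_logGaussAvg, ← hw.gaussAvg_gaussAvg]
    have hFk := hF.logGaussAvg √(k * h)
    have hGk := hG.logGaussAvg √(k * h)
    have hwk := hw.gaussAvg √(k * h)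
    obtain ⟨p, hpK, hp⟩ := hS √(k * h) (b + u)
    have hhard := hFk.log_le_integral_shift_add h0 h1 (b + u) p hpK hp
    have heasy := hGk.integral_shift_sub_le_log √h (b + s • u) ((√h * s) • p)
    have hGi : Integrable (fun y => logGaussAvg G √(k * h)
        (b + s • u + √h • y + √h • (√h * s) • p)) (stdGaussian n) := by
      simpa only [add_right_comm] using
        hGk.integrable_stdGaussian √h (b + s • u + √h • (√h * s) • p)
    have hwi := hwk.integrable_stdGaussian √h b
    have hFi : Integrable (fun y => logGaussAvg F √(k * h) (b + u + √h • y + h • p))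
        (stdGaussian n) := by
      simpa only [add_right_comm] using hFk.integrable_stdGaussian √h (b + u + h • p)
    have hstep : ∫ y, logGaussAvg F √(k * h) (b + u + √h • y + h • p) ∂(stdGaussian n) ≤
        ∫ y, (s⁻¹ ^ 2 * logGaussAvg G √(k * h) (b + s • u + √h • y + √h • (√h * s) • p) +
          gaussAvg w √(k * h) (b + √h • y) + k * C) ∂(stdGaussian n) := by
      refine integral_mono hFi (((hGi.const_mul _).add hwi).add (integrable_const _)) fun y => ?_
      have := ih (b + √h • y) (u + h • p)
      have e1 : b + √h • y + (u + h • p) = b + u + √h • y + h • p := by abel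
      have e2 : b + √h • y + s • (u + h • p) = b + s • u + √h • y + √h • (√h * s) • p := by
        rw [smul_add, smul_smul, smul_smul, ← mul_assoc, Real.mul_self_sqrt h0, mul_comm h]
        abel
      rwa [e1, e2] at this
    rw [integral_add (f := fun y =>
        s⁻¹ ^ 2 * logGaussAvg G √(k * h) (b + s • u + √h • y + √h • (√h * s) • p) +
          gaussAvg w √(k * h) (b + √h • y)) ((hGi.const_mul _).add hwi) (integrable_const _),
      integral_add (hGi.const_mul _) hwi, integral_const_mul] at hstep
    have heasy' := mul_le_mul_of_nonneg_left heasy (sq_nonneg s⁻¹)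
    have hnorm : s⁻¹ ^ 2 * (‖(√h * s) • p‖ ^ 2 / 2) = h * ‖p‖ ^ 2 / 2 := by
      rw [norm_smul, Real.norm_of_nonneg (by positivity), mul_pow, mul_pow, Real.sq_sqrt h0]
      field_simp
    rw [mul_sub, hnorm] at heasy'
    simp only [integral_const, probReal_univ, one_smul] at hstep
    push_cast
    linarith

lemma logGaussAvg_le_of_smooth {K K' Kw : ℝ≥0} {F G w : EuclideanSpace ℝ (Fin n) → ℝ}
    (hF : LipschitzWith K F) (hG : LipschitzWith K' G) (hw : LipschitzWith Kw w) {M s : ℝ}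
    (hs : 0 < s) {D : EuclideanSpace ℝ (Fin n) → EuclideanSpace ℝ (Fin n)}
    (hD : Continuous D) (hDK : ∀ x, ‖D x‖ ≤ K)
    (hS : ∀ x z, |F (x + z) - F x - ⟪D x, z⟫| ≤ M * ‖z‖ ^ 2)
    (hFG : ∀ b u, F (b + u) ≤ s⁻¹ ^ 2 * G (b + s • u) + w b) :
    logGaussAvg F 1 0 ≤ s⁻¹ ^ 2 * logGaussAvg G 1 0 + gaussAvg w 1 0 := by
  set C := 24 * (M + K ^ 2 / 2) ^ 2 *
    (∫ y, Real.exp ((2 * K + 1) * (‖y‖ + K)) ∂(stdGaussian n)) with hC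
  have hlim : Filter.Tendsto (fun N : ℕ => s⁻¹ ^ 2 * logGaussAvg G 1 0 + gaussAvg w 1 0 +
      C * (1 / ((N : ℝ) + 1))) Filter.atTop
      (nhds (s⁻¹ ^ 2 * logGaussAvg G 1 0 + gaussAvg w 1 0 + C * 0)) :=
    (tendsto_one_div_add_atTop_nhds_zero_nat.const_mul C).const_add _
  rw [mul_zero, add_zero] at hlim
  refine ge_of_tendsto' hlim fun N => ?_
  have hN : (0 : ℝ) < N + 1 := by positivity
  have h := logGaussAvg_discrete_le hF hG hw hs (h := 1 / ((N : ℝ) + 1)) (by positivity)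
    (by rw [div_le_one hN]; linarith [(Nat.cast_nonneg N : (0 : ℝ) ≤ N)])
    (exists_abs_logGaussAvg_sub_le hF hD hDK hS) hFG (N + 1) 0 0
  have h1 : ((N + 1 : ℕ) : ℝ) * (1 / ((N : ℝ) + 1)) = 1 := by
    push_cast
    field_simp
  rw [h1, Real.sqrt_one, smul_zero, add_zero, ← hC] at h
  have h2 : ((N + 1 : ℕ) : ℝ) * (C * (1 / ((N : ℝ) + 1)) ^ 2) = C * (1 / ((N : ℝ) + 1)) := by
    push_cast
    field_simp
  rwa [h2] at h

/-- A Lipschitz function is uniformly approximated by Lipschitz functions with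
Lipschitz gradient. -/
lemma LipschitzWith.exists_smooth_approx {K : ℝ≥0} {f : EuclideanSpace ℝ (Fin n) → ℝ}
    (hf : LipschitzWith K f) {δ : ℝ} (hδ : 0 < δ) :
    ∃ (F : EuclideanSpace ℝ (Fin n) → ℝ)
      (D : EuclideanSpace ℝ (Fin n) → EuclideanSpace ℝ (Fin n)) (M : ℝ),
      LipschitzWith K F ∧ Continuous D ∧ (∀ x, ‖D x‖ ≤ K) ∧
      (∀ x z, |F (x + z) - F x - ⟪D x, z⟫| ≤ M * ‖z‖ ^ 2) ∧ ∀ x, |F x - f x| ≤ δ := by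
  have hr : 0 < δ / (K + 1) := by positivity
  let φ : ContDiffBump (0 : EuclideanSpace ℝ (Fin n)) := ⟨δ / (K + 1) / 2, δ / (K + 1),
    by positivity, by linarith⟩
  set ψ := φ.normed volume with hψ
  have hψ1 : ContDiff ℝ 1 ψ := φ.contDiff_normed
  have hψs : HasCompactSupport ψ := φ.hasCompactSupport_normed
  have hψd : Continuous (fderiv ℝ ψ) := hψ1.continuous_fderiv one_ne_zero
  have hψds : HasCompactSupport (fderiv ℝ ψ) := hψs.fderiv (𝕜 := ℝ)
  set F : EuclideanSpace ℝ (Fin n) → ℝ := ψ ⋆[ContinuousLinearMap.lsmul ℝ ℝ, volume] f with hF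
  have hfc := hf.continuous
  have hψi : Integrable ψ := hψ1.continuous.integrable_of_hasCompactSupport hψs
  have hψc : Continuous ψ := hψ1.continuous
  have hinteg : ∀ x, Integrable fun t => ψ t * f (x - t) := fun x =>
    (by fun_prop : Continuous fun t => ψ t * f (x - t)).integrable_of_hasCompactSupport
      hψs.mul_right
  have hFlip : LipschitzWith K F := by
    refine LipschitzWith.of_le_add_mul K fun x y => ?_
    have h1 : ∫ t, ψ t * f (x - t) ≤ ∫ t, (ψ t * f (y - t) + ψ t * (K * dist x y)) := by
      refine integral_mono (hinteg x) ((hinteg y).add (hψi.mul_const _)) fun t => ?_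
      simp only []
      rw [← mul_add]
      refine mul_le_mul_of_nonneg_left ?_ (φ.nonneg_normed t)
      have := hf.le_add_mul (x - t) (y - t)
      rwa [dist_sub_right] at this
    rw [integral_add (hinteg y) (hψi.mul_const _), integral_mul_const, φ.integral_normed,
      one_mul] at h1
    exact h1
  have hder : ∀ x, HasFDerivAt F ((fderiv ℝ ψ ⋆[ContinuousLinearMap.precompL
      (EuclideanSpace ℝ (Fin n)) (ContinuousLinearMap.lsmul ℝ ℝ), volume] f) x) x := fun x =>
    hψs.hasFDerivAt_convolution_left _ hψ1 hfc.locallyIntegrable x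
  set D' := fderiv ℝ ψ ⋆[ContinuousLinearMap.precompL
      (EuclideanSpace ℝ (Fin n)) (ContinuousLinearMap.lsmul ℝ ℝ), volume] f with hD'
  have hD'K : ∀ x, ‖D' x‖ ≤ K := fun x => (hder x).le_of_lipschitz hFlip
  have hD'int : ∀ x, Integrable fun t => (ContinuousLinearMap.precompL
      (EuclideanSpace ℝ (Fin n)) (ContinuousLinearMap.lsmul ℝ ℝ)) (fderiv ℝ ψ t) (f (x - t)) :=
    fun x => hψds.convolutionExists_left _ hψd hfc.locallyIntegrable x
  set M := K * ∫ t, ‖fderiv ℝ ψ t‖ with hM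
  have hD'lip : ∀ x y, ‖D' x - D' y‖ ≤ M * ‖x - y‖ := by
    intro x y
    rw [hD', convolution_def, convolution_def, ← integral_sub (hD'int x) (hD'int y)]
    refine (norm_integral_le_of_norm_le ((hψd.norm.integrable_of_hasCompactSupport
      hψds.norm).mul_const (K * ‖x - y‖)) (Filter.Eventually.of_forall fun t => ?_)).trans_eq ?_
    · rw [← map_sub]
      have e : (ContinuousLinearMap.precompL (EuclideanSpace ℝ (Fin n))
          (ContinuousLinearMap.lsmul ℝ ℝ)) (fderiv ℝ ψ t) (f (x - t) - f (y - t)) =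
          (f (x - t) - f (y - t)) • fderiv ℝ ψ t := by
        ext v
        simp [ContinuousLinearMap.precompL_apply, mul_comm]
        ring
      rw [e, norm_smul, mul_comm]
      gcongr
      have := hf.dist_le_mul (x - t) (y - t)
      rwa [dist_sub_right, Real.dist_eq, dist_eq_norm] at this
    · rw [integral_mul_const, hM]
      ring
  have hD'c : Continuous D' := by
    have hM0 : 0 ≤ M := mul_nonneg K.2 (integral_nonneg fun t => norm_nonneg _)
    refine (LipschitzWith.of_dist_le_mul (K := ⟨M, hM0⟩) fun x y => ?_).continuous
    rw [dist_eq_norm, dist_eq_norm]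
    exact hD'lip x y
  refine ⟨F, fun x => (InnerProductSpace.toDual ℝ _).symm (D' x), M, hFlip, by fun_prop,
    fun x => by simpa using hD'K x, fun x z => ?_, fun x => ?_⟩
  · have hM0 : 0 ≤ M := mul_nonneg K.2 (integral_nonneg fun t => norm_nonneg _)
    rw [InnerProductSpace.toDual_symm_apply]
    have := (convex_closedBall x ‖z‖).norm_image_sub_le_of_norm_hasFDerivWithin_le'
      (f := F) (f' := D') (φ := D' x) (C := M * ‖z‖) (x := x) (y := x + z)
      (fun y _ => (hder y).hasFDerivWithinAt)
      (fun y hy => (hD'lip y x).trans (by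
        rw [mem_closedBall_iff_norm] at hy
        gcongr)) (by simp) (by simp)
    rw [add_sub_cancel_left] at this
    rw [sq, ← mul_assoc]
    exact this
  · have := ContDiffBump.dist_normed_convolution_le (μ := volume) (φ := φ) (x₀ := x) (g := f)
      (ε := δ) hfc.aestronglyMeasurable fun y hy => by
        refine (hf.dist_le_mul y x).trans ?_
        have hy' : dist y x ≤ δ / (K + 1) := (Metric.mem_ball.1 hy).le
        calc (K : ℝ) * dist y x ≤ (K + 1) * (δ / (K + 1)) := by
              gcongr
              linarith
          _ = δ := by field_simp
    exact this

/-- If `f (b + u) ≤ s⁻² G (b + s u) + w b` for all `b` and `u`, then the same holds with `f`,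
`G` replaced by their Gaussian log-Laplace transforms and `w` by its Gaussian mean. -/
lemma logGaussAvg_le {K K' Kw : ℝ≥0} {f G w : EuclideanSpace ℝ (Fin n) → ℝ}
    (hf : LipschitzWith K f) (hG : LipschitzWith K' G) (hw : LipschitzWith Kw w) {s : ℝ}
    (hs : 0 < s) (hfG : ∀ b u, f (b + u) ≤ s⁻¹ ^ 2 * G (b + s • u) + w b) :
    logGaussAvg f 1 0 ≤ s⁻¹ ^ 2 * logGaussAvg G 1 0 + gaussAvg w 1 0 := by
  refine le_of_forall_pos_le_add fun δ hδ => ?_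
  obtain ⟨F, D, M, hF, hDc, hDK, hS, hFf⟩ := hf.exists_smooth_approx (half_pos hδ)
  have h1 := logGaussAvg_le_of_smooth hF hG (w := fun b => w b + δ / 2) (Kw := Kw)
    (by simpa using hw.add (LipschitzWith.const (δ / 2))) hs hDc hDK hS fun b u => by
      linarith [hfG b u, (abs_le.1 (hFf (b + u))).2]
  have h2 : gaussAvg (fun b => w b + δ / 2) 1 0 = gaussAvg w 1 0 + δ / 2 := by
    rw [gaussAvg, integral_add (hw.integrable_stdGaussian 1 0) (integrable_const _)]
    simp [gaussAvg]
  have h3 : ∫ y, Real.exp (f (0 + (1 : ℝ) • y)) ∂(stdGaussian n) ≤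
      ∫ y, Real.exp (F (0 + (1 : ℝ) • y)) * Real.exp (δ / 2) ∂(stdGaussian n) := by
    refine integral_mono (hf.integrable_exp_stdGaussian 1 0)
      ((hF.integrable_exp_stdGaussian 1 0).mul_const _) fun y => ?_
    simp only []
    rw [← Real.exp_add]
    refine Real.exp_le_exp.2 ?_
    linarith [(abs_le.1 (hFf (0 + (1 : ℝ) • y))).1]
  rw [integral_mul_const, ← hf.exp_logGaussAvg, ← hF.exp_logGaussAvg, ← Real.exp_add,
    Real.exp_le_exp] at h3
  linarith

end StaticInequality

section Width

open scoped NNReal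

variable {n : ℕ} {S : Set (EuclideanSpace ℝ (Fin n))}

lemma exists_norm_le_of_bddAbove_inner
    (hS : ∀ y : EuclideanSpace ℝ (Fin n),
      BddAbove (Set.range fun t : S => ⟪y, (t : EuclideanSpace ℝ (Fin n))⟫)) :
    ∃ R : ℝ≥0, ∀ t ∈ S, ‖t‖ ≤ R := by
  obtain ⟨C, hC⟩ := banach_steinhaus
    (g := fun t : S => innerSL ℝ (t : EuclideanSpace ℝ (Fin n))) fun y => by
      obtain ⟨a, ha⟩ := hS y
      obtain ⟨b, hb⟩ := hS (-y)
      refine ⟨max a b, fun t => ?_⟩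
      have h1 := ha ⟨t, rfl⟩
      have h2 := hb ⟨t, rfl⟩
      simp only [inner_neg_left] at h2
      rw [innerSL_apply_apply, real_inner_comm, Real.norm_eq_abs]
      exact abs_le.2 ⟨by linarith [le_max_right a b], h1.trans (le_max_left a b)⟩
  refine ⟨C.toNNReal, fun t ht => ?_⟩
  have := hC ⟨t, ht⟩
  rw [innerSL_apply_norm] at this
  exact this.trans (Real.le_coe_toNNReal C)

lemma inner_le_gaussWidthFn {y t : EuclideanSpace ℝ (Fin n)}
    (hS : BddAbove (Set.range fun t : S => ⟪y, (t : EuclideanSpace ℝ (Fin n))⟫)) (ht : t ∈ S) :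
    ⟪y, t⟫ ≤ gaussWidthFn S y :=
  le_ciSup hS ⟨t, ht⟩

lemma gaussWidthFn_smul {c : ℝ} (hc : 0 ≤ c) (y : EuclideanSpace ℝ (Fin n)) :
    gaussWidthFn S (c • y) = c * gaussWidthFn S y := by
  simp only [gaussWidthFn, real_inner_smul_left, Real.mul_iSup_of_nonneg hc]

lemma lipschitzWith_gaussWidthFn (hne : S.Nonempty) {R : ℝ≥0} (hR : ∀ t ∈ S, ‖t‖ ≤ R)
    (hS : ∀ y : EuclideanSpace ℝ (Fin n),
      BddAbove (Set.range fun t : S => ⟪y, (t : EuclideanSpace ℝ (Fin n))⟫)) :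
    LipschitzWith R (gaussWidthFn S) := by
  have := hne.to_subtype
  refine LipschitzWith.of_le_add_mul R fun x y => ciSup_le fun t => ?_
  have h1 := inner_le_gaussWidthFn (hS y) t.2
  have h2 := real_inner_le_norm (x - y) t
  have h3 := mul_le_mul_of_nonneg_left (hR t t.2) (norm_nonneg (x - y))
  rw [inner_sub_left] at h2
  rw [dist_eq_norm]
  linarith

lemma norm_fderiv_eq_norm_gradient (f : EuclideanSpace ℝ (Fin n) → ℝ)
    (x : EuclideanSpace ℝ (Fin n)) : ‖fderiv ℝ f x‖ = ‖gradient f x‖ := by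
  simp [gradient]

lemma fderiv_apply_eq_inner_gradient (f : EuclideanSpace ℝ (Fin n) → ℝ)
    (x v : EuclideanSpace ℝ (Fin n)) : fderiv ℝ f x v = ⟪gradient f x, v⟫ := by
  simp [gradient]

lemma sub_le_gaussWidthFn_range_gradient {f : EuclideanSpace ℝ (Fin n) → ℝ}
    (hf : Differentiable ℝ f)
    (hS : ∀ y : EuclideanSpace ℝ (Fin n),
      BddAbove (Set.range fun t : Set.range (gradient f) =>
        ⟪y, (t : EuclideanSpace ℝ (Fin n))⟫))
    (x y : EuclideanSpace ℝ (Fin n)) :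
    f x - f y ≤ gaussWidthFn (Set.range (gradient f)) (x - y) := by
  obtain ⟨z, -, hz⟩ := domain_mvt (s := Set.univ)
    (fun x _ => (hf x).hasFDerivAt.hasFDerivWithinAt) convex_univ (Set.mem_univ y) (Set.mem_univ x)
  rw [hz, fderiv_apply_eq_inner_gradient, real_inner_comm]
  exact inner_le_gaussWidthFn (hS _) ⟨z, rfl⟩

lemma lipschitzWith_of_norm_gradient_le {f : EuclideanSpace ℝ (Fin n) → ℝ}
    (hf : Differentiable ℝ f) {R : ℝ≥0} (hR : ∀ x, ‖gradient f x‖ ≤ R) :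
    LipschitzWith R f :=
  lipschitzWith_of_nnnorm_fderiv_le hf fun x => by
    rw [← NNReal.coe_le_coe, coe_nnnorm, norm_fderiv_eq_norm_gradient]
    exact hR x

end Width

section Tilt

open scoped NNReal

variable {n : ℕ} {f : EuclideanSpace ℝ (Fin n) → ℝ}

lemma integral_withDensity_exp_stdGaussian (hf : Continuous f)
    {F : Type*} [NormedAddCommGroup F] [NormedSpace ℝ F] (g : EuclideanSpace ℝ (Fin n) → F) :
    ∫ x, g x ∂((stdGaussian n).withDensity fun x => ENNReal.ofReal (Real.exp (f x))) =
      ∫ x, Real.exp (f x) • g x ∂(stdGaussian n) := by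
  rw [integral_withDensity_eq_integral_toReal_smul (by fun_prop)
    (Filter.Eventually.of_forall fun _ => ENNReal.ofReal_lt_top)]
  simp [ENNReal.toReal_ofReal, Real.exp_nonneg]

lemma integrable_withDensity_exp_stdGaussian_iff (hf : Continuous f)
    {F : Type*} [NormedAddCommGroup F] [NormedSpace ℝ F] {g : EuclideanSpace ℝ (Fin n) → F} :
    Integrable g ((stdGaussian n).withDensity fun x => ENNReal.ofReal (Real.exp (f x))) ↔
      Integrable (fun x => Real.exp (f x) • g x) (stdGaussian n) := by
  rw [integrable_withDensity_iff_integrable_smul' (by fun_prop)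
    (Filter.Eventually.of_forall fun _ => ENNReal.ofReal_lt_top)]
  simp [ENNReal.toReal_ofReal, Real.exp_nonneg]

lemma LipschitzWith.integrable_exp_mul_norm_withDensity {K : ℝ≥0} (hf : LipschitzWith K f)
    (c : ℝ) :
    Integrable (fun x => Real.exp (c * ‖x‖))
      ((stdGaussian n).withDensity fun x => ENNReal.ofReal (Real.exp (f x))) := by
  have hc := hf.continuous
  rw [integrable_withDensity_exp_stdGaussian_iff hc]
  refine Integrable.mono' ((integrable_exp_mul_norm_stdGaussian (K + c)).const_mul
    (Real.exp (f 0))) (by fun_prop) (Filter.Eventually.of_forall fun x => ?_)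
  rw [smul_eq_mul, Real.norm_of_nonneg (by positivity), ← Real.exp_add, ← Real.exp_add]
  have := (abs_le.1 (hf.le_add_mul_norm 0 x)).2
  rw [zero_add] at this
  exact Real.exp_le_exp.2 (by linarith)

lemma LipschitzWith.integrable_norm_withDensity {K : ℝ≥0} (hf : LipschitzWith K f) :
    Integrable (fun x => ‖x‖)
      ((stdGaussian n).withDensity fun x => ENNReal.ofReal (Real.exp (f x))) := by
  refine Integrable.mono' (hf.integrable_exp_mul_norm_withDensity 1) (by fun_prop)
    (Filter.Eventually.of_forall fun x => ?_)
  rw [norm_norm]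
  linarith [Real.add_one_le_exp (1 * ‖x‖)]

lemma LipschitzWith.integrable_exp_withDensity {K L : ℝ≥0} (hf : LipschitzWith K f)
    {g : EuclideanSpace ℝ (Fin n) → ℝ} (hg : LipschitzWith L g) :
    Integrable (fun x => Real.exp (g x))
      ((stdGaussian n).withDensity fun x => ENNReal.ofReal (Real.exp (f x))) := by
  have hc := hg.continuous
  refine Integrable.mono' ((hf.integrable_exp_mul_norm_withDensity L).const_mul (Real.exp (g 0)))
    (by fun_prop) (Filter.Eventually.of_forall fun x => ?_)
  rw [Real.norm_of_nonneg (by positivity), ← Real.exp_add]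
  have := (abs_le.1 (hg.le_add_mul_norm 0 x)).2
  rw [zero_add] at this
  gcongr
  linarith

end Tilt

section Dilation

open scoped NNReal Topology

variable {n : ℕ} {f w : EuclideanSpace ℝ (Fin n) → ℝ} {K : ℝ≥0}

lemma integral_dilation_sub_le {Kw : ℝ≥0} (hf : LipschitzWith K f) (hw : LipschitzWith Kw w)
    (hfw : ∀ x y, f x - f y ≤ w (x - y)) (hsmul : ∀ c : ℝ, 0 ≤ c → ∀ y, w (c • y) = c * w y)
    {ν : Measure (EuclideanSpace ℝ (Fin n))} [IsProbabilityMeasure ν]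
    (hν : ν = (stdGaussian n).withDensity fun x => ENNReal.ofReal (Real.exp (f x)))
    {t : ℝ} (ht : 0 ≤ t) :
    ∫ x, (f ((1 + t) • x) - f x) ∂ν ≤
      (1 + t)⁻¹ ^ 2 * ProbabilityTheory.cgf f ν ((1 + t) ^ 2 - 1) +
        t * ∫ y, w y ∂(stdGaussian n) := by
  have hc := hf.continuous
  have hs : 0 < 1 + t := by positivity
  have hfs : LipschitzWith (K * ‖1 + t‖₊) fun x => f ((1 + t) • x) :=
    hf.comp (lipschitzWith_smul (1 + t))
  have hG : LipschitzWith (‖(1 + t) ^ 2‖₊ * K) fun x => (1 + t) ^ 2 * f x :=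
    (lipschitzWith_smul ((1 + t) ^ 2 : ℝ)).comp hf
  have hwt : LipschitzWith (Kw * ‖t‖₊) fun x => w (t • x) := hw.comp (lipschitzWith_smul t)
  have key := logGaussAvg_le hfs hG hwt hs fun b u => by
    have h1 := hfw ((1 + t) • (b + u)) (b + (1 + t) • u)
    have h2 : (1 + t) • (b + u) - (b + (1 + t) • u) = t • b := by module
    rw [h2] at h1
    have h3 : (1 + t)⁻¹ ^ 2 * ((1 + t) ^ 2 * f (b + (1 + t) • u)) = f (b + (1 + t) • u) := by
      field_simp
    rw [h3]
    linarith
  have hJ := integral_le_log_integral_exp (μ := ν) (X := fun x => f ((1 + t) • x) - f x) ?_ ?_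
  · have e1 : ∫ x, Real.exp (f ((1 + t) • x) - f x) ∂ν =
        ∫ x, Real.exp (f ((1 + t) • x)) ∂(stdGaussian n) := by
      rw [hν, integral_withDensity_exp_stdGaussian hc]
      simp [← Real.exp_add]
    have e2 : ∫ x, Real.exp (((1 + t) ^ 2 - 1) * f x) ∂ν =
        ∫ x, Real.exp ((1 + t) ^ 2 * f x) ∂(stdGaussian n) := by
      rw [hν, integral_withDensity_exp_stdGaussian hc]
      congr 1 with x
      rw [smul_eq_mul, ← Real.exp_add]
      ring_nf
    rw [e1] at hJ
    simp only [logGaussAvg, gaussAvg, zero_add, one_smul, hsmul t ht, integral_const_mul] at key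
    rw [ProbabilityTheory.cgf, ProbabilityTheory.mgf, e2]
    exact hJ.trans key
  · rw [hν]
    refine Integrable.mono' ((hf.integrable_norm_withDensity).const_mul (K * t)) (by fun_prop)
      (Filter.Eventually.of_forall fun x => ?_)
    have := hf.le_add_mul_norm x (t • x)
    rw [norm_smul, Real.norm_of_nonneg ht] at this
    rw [add_smul, one_smul, Real.norm_eq_abs]
    linarith
  · rw [hν]
    exact hf.integrable_exp_withDensity (hfs.sub hf)

lemma integral_inner_gradient_le {Kw : ℝ≥0} (hf : LipschitzWith K f) (hd : ContDiff ℝ 1 f)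
    (hw : LipschitzWith Kw w) (hfw : ∀ x y, f x - f y ≤ w (x - y))
    (hsmul : ∀ c : ℝ, 0 ≤ c → ∀ y, w (c • y) = c * w y)
    {ν : Measure (EuclideanSpace ℝ (Fin n))} [IsProbabilityMeasure ν]
    (hν : ν = (stdGaussian n).withDensity fun x => ENNReal.ofReal (Real.exp (f x))) :
    ∫ x, ⟪gradient f x, x⟫ ∂ν ≤ 2 * ∫ x, f x ∂ν + ∫ y, w y ∂(stdGaussian n) := by
  have hc := hf.continuous
  have hL : Filter.Tendsto (fun t : ℝ => ∫ x, t⁻¹ * (f ((1 + t) • x) - f x) ∂ν) (𝓝[>] 0)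
      (𝓝 (∫ x, ⟪gradient f x, x⟫ ∂ν)) := by
    refine tendsto_integral_filter_of_dominated_convergence (fun x => K * ‖x‖)
      (Filter.Eventually.of_forall fun t => ?_) ?_ ?_ (Filter.Eventually.of_forall fun x => ?_)
    · exact Continuous.aestronglyMeasurable (by fun_prop)
    · filter_upwards [self_mem_nhdsWithin] with t (ht : 0 < t)
      refine Filter.Eventually.of_forall fun x => ?_
      have := hf.le_add_mul_norm x (t • x)
      rw [norm_smul, Real.norm_of_nonneg ht.le] at this
      rw [add_smul, one_smul, norm_mul, norm_inv, Real.norm_eq_abs, Real.norm_eq_abs,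
        abs_of_pos ht, inv_mul_le_iff₀ ht]
      linarith
    · rw [hν]
      exact hf.integrable_norm_withDensity.const_mul _
    · have h1 : HasDerivAt (fun t : ℝ => (1 + t) • x) x 0 := by
        simpa using ((hasDerivAt_id (0 : ℝ)).const_add 1).smul_const x
      have h2 : HasFDerivAt f (fderiv ℝ f x) ((1 + (0 : ℝ)) • x) := by
        simpa using (hd.differentiable one_ne_zero x).hasFDerivAt
      have h3 := (h2.comp_hasDerivAt (0 : ℝ) h1).tendsto_slope_zero_right
      simpa only [← fderiv_apply_eq_inner_gradient, Function.comp_apply, add_zero, zero_add, one_smul,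
        smul_eq_mul] using h3
  have hcgf : HasDerivAt (ProbabilityTheory.cgf f ν) (∫ x, f x ∂ν) 0 := by
    have h0 : (0 : ℝ) ∈ interior (ProbabilityTheory.integrableExpSet f ν) := by
      have : ProbabilityTheory.integrableExpSet f ν = Set.univ := by
        refine Set.eq_univ_of_forall fun u => ?_
        rw [ProbabilityTheory.integrableExpSet, Set.mem_ofPred_eq, hν]
        exact hf.integrable_exp_withDensity ((lipschitzWith_smul u).comp hf)
      simp [this]
    have h1 := (ProbabilityTheory.analyticAt_cgf h0).differentiableAt.hasDerivAt
    rwa [ProbabilityTheory.deriv_cgf_zero h0, probReal_univ, div_one] at h1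
  have hR : Filter.Tendsto (fun t : ℝ => t⁻¹ *
      ((1 + t)⁻¹ ^ 2 * ProbabilityTheory.cgf f ν ((1 + t) ^ 2 - 1)) +
        ∫ y, w y ∂(stdGaussian n)) (𝓝[>] 0)
      (𝓝 (2 * ∫ x, f x ∂ν + ∫ y, w y ∂(stdGaussian n))) := by
    refine Filter.Tendsto.add_const _ ?_
    have h1 : HasDerivAt (fun t : ℝ => 1 + t) 1 0 := (hasDerivAt_id (0 : ℝ)).const_add 1
    have h2 : HasDerivAt (fun t : ℝ => (1 + t) ^ 2 - 1) 2 0 := by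
      simpa using (h1.pow 2).sub_const 1
    have h3 : HasDerivAt (ProbabilityTheory.cgf f ν) (∫ x, f x ∂ν) ((1 + (0 : ℝ)) ^ 2 - 1) := by
      simpa using hcgf
    have h4 : HasDerivAt (fun t : ℝ => ProbabilityTheory.cgf f ν ((1 + t) ^ 2 - 1))
        ((∫ x, f x ∂ν) * 2) 0 := 
      HasDerivAt.comp (h₂ := ProbabilityTheory.cgf f ν) (0 : ℝ) h3 h2
    have h5 := ((h1.inv (by norm_num)).pow 2).mul h4
    have h6 := h5.tendsto_slope_zero_right
    simpa [mul_comm] using h6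
  refine le_of_tendsto_of_tendsto hL hR ?_
  filter_upwards [self_mem_nhdsWithin] with t (ht : 0 < t)
  rw [integral_const_mul, inv_mul_le_iff₀ ht, mul_add, mul_inv_cancel_left₀ ht.ne']
  exact integral_dilation_sub_le hf hw hfw hsmul hν ht.le

end Dilation

section IntegrationByParts

open scoped NNReal Topology

variable {n : ℕ} {f χ : EuclideanSpace ℝ (Fin n) → ℝ}

lemma contDiff_gradient (hf : ContDiff ℝ 2 f) : ContDiff ℝ 1 (gradient f) :=
  (InnerProductSpace.toDual ℝ (EuclideanSpace ℝ (Fin n))).symm.contDiff.comp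
    (hf.fderiv_right (m := 1) (by norm_num))

lemma fderiv_const_mul_exp_mul_gradient_apply (hf : ContDiff ℝ 2 f) (c : ℝ) (i : Fin n)
    (x : EuclideanSpace ℝ (Fin n)) :
    fderiv ℝ (fun x => c * Real.exp (f x - ‖x‖ ^ 2 / 2) * gradient f x i) x
        (EuclideanSpace.single i 1) =
      c * Real.exp (f x - ‖x‖ ^ 2 / 2) *
        (fderiv ℝ (gradient f) x (EuclideanSpace.single i 1) i +
          gradient f x i * gradient f x i - gradient f x i * x i) := by
  have h1 : HasFDerivAt (gradient f) (fderiv ℝ (gradient f) x) x :=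
    ((contDiff_gradient hf).differentiable one_ne_zero x).hasFDerivAt
  have h2 : HasFDerivAt (fun x => gradient f x i)
      ((EuclideanSpace.proj i).comp (fderiv ℝ (gradient f) x)) x :=
    (EuclideanSpace.proj i : EuclideanSpace ℝ (Fin n) →L[ℝ] ℝ).hasFDerivAt.comp x h1
  have h3 : HasFDerivAt f (fderiv ℝ f x) x := (hf.differentiable two_ne_zero x).hasFDerivAt
  have h4 := (((h3.sub ((hasStrictFDerivAt_norm_sq x).hasFDerivAt.mul_const (1 / 2))).exp).const_mul
    c).mul h2
  have h5 : (fun x => c * Real.exp (f x - ‖x‖ ^ 2 / 2) * gradient f x i) =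
      fun x => c * Real.exp (f x - ‖x‖ ^ 2 * (1 / 2)) * gradient f x i := by
    ext y
    ring_nf
  have h6 : fderiv ℝ (fun x => c * Real.exp (f x - ‖x‖ ^ 2 * (1 / 2)) * gradient f x i) x = _ :=
    h4.fderiv
  have h7 : fderiv ℝ f x (EuclideanSpace.single i 1) = gradient f x i := by
    rw [fderiv_apply_eq_inner_gradient, EuclideanSpace.inner_single_right]
    simp
  rw [h5, h6]
  simp [h7, EuclideanSpace.inner_single_right]
  ring_nf

lemma integral_mul_lap_add_eq (hf : ContDiff ℝ 2 f) (hχ : ContDiff ℝ 1 χ)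
    (hχs : HasCompactSupport χ) :
    ∫ x, χ x * (lap f x + ‖gradient f x‖ ^ 2 - ⟪gradient f x, x⟫)
        ∂((stdGaussian n).withDensity fun x => ENNReal.ofReal (Real.exp (f x))) =
      - ∫ x, fderiv ℝ χ x (gradient f x)
        ∂((stdGaussian n).withDensity fun x => ENNReal.ofReal (Real.exp (f x))) := by
  obtain ⟨c, hc⟩ : ∃ c : ℝ, (2 * π) ^ (-(n : ℝ) / 2) = c := ⟨_, rfl⟩
  have hν : ∀ g : EuclideanSpace ℝ (Fin n) → ℝ,
      ∫ x, g x ∂((stdGaussian n).withDensity fun x => ENNReal.ofReal (Real.exp (f x))) =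
        ∫ x, c * Real.exp (f x - ‖x‖ ^ 2 / 2) * g x := fun g => by
    rw [integral_withDensity_exp_stdGaussian hf.continuous, integral_stdGaussian]
    congr 1 with x
    rw [smul_eq_mul, smul_eq_mul, hc,
      show f x - ‖x‖ ^ 2 / 2 = -‖x‖ ^ 2 / 2 + f x by ring, Real.exp_add]
    ring
  have hg := contDiff_gradient hf
  have hV : ∀ i : Fin n, ContDiff ℝ 1
      (fun x => c * Real.exp (f x - ‖x‖ ^ 2 / 2) * gradient f x i) := fun i => by
    have h1 : ContDiff ℝ 1 f := hf.of_le one_le_two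
    have h2 : ContDiff ℝ 1 (fun x => gradient f x i) :=
      (EuclideanSpace.proj i : EuclideanSpace ℝ (Fin n) →L[ℝ] ℝ).contDiff.comp hg
    have h3 : ContDiff ℝ 1 (fun x : EuclideanSpace ℝ (Fin n) => ‖x‖ ^ 2) := contDiff_norm_sq ℝ
    exact (contDiff_const.mul (h1.sub (h3.div_const 2)).exp).mul h2
  have hχ' : Continuous (fderiv ℝ χ) := hχ.continuous_fderiv one_ne_zero
  have hI1 : ∀ i : Fin n, Integrable fun x => fderiv ℝ χ x (EuclideanSpace.single i 1) *
      (c * Real.exp (f x - ‖x‖ ^ 2 / 2) * gradient f x i) := fun i =>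
    ((hχ'.clm_apply continuous_const).mul (hV i).continuous).integrable_of_hasCompactSupport
      ((hχs.fderiv_apply ℝ _).mul_right)
  have hI2 : ∀ i : Fin n, Integrable fun x => χ x *
      fderiv ℝ (fun x => c * Real.exp (f x - ‖x‖ ^ 2 / 2) * gradient f x i) x
        (EuclideanSpace.single i 1) := fun i =>
    (hχ.continuous.mul (((hV i).continuous_fderiv one_ne_zero).clm_apply
      continuous_const)).integrable_of_hasCompactSupport hχs.mul_right
  have hI3 : ∀ i : Fin n, Integrable fun x => χ x *
      (c * Real.exp (f x - ‖x‖ ^ 2 / 2) * gradient f x i) := fun i =>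
    (hχ.continuous.mul (hV i).continuous).integrable_of_hasCompactSupport hχs.mul_right
  have hibp := fun i => integral_mul_fderiv_eq_neg_fderiv_mul_of_integrable (hI1 i) (hI2 i) (hI3 i)
    (fun x _ => hχ.differentiable one_ne_zero x)
    (fun x _ => (hV i).differentiable one_ne_zero x)
  have hsum := Finset.sum_congr (rfl : (Finset.univ : Finset (Fin n)) = Finset.univ)
    fun i _ => hibp i
  rw [Finset.sum_neg_distrib, ← integral_finsetSum _ fun i _ => hI1 i,
    ← integral_finsetSum _ fun i _ => hI2 i] at hsum
  rw [hν, hν]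
  refine (integral_congr_ae (ae_of_all _ fun x => ?_)).trans
    (hsum.trans (congrArg Neg.neg (integral_congr_ae (ae_of_all _ fun x => ?_))))
  · simp only [fderiv_const_mul_exp_mul_gradient_apply hf]
    have e1 : ‖gradient f x‖ ^ 2 = ∑ i, gradient f x i * gradient f x i := by
      rw [EuclideanSpace.real_norm_sq_eq]
      simp only [sq]
    have e2 : ⟪gradient f x, x⟫ = ∑ i, gradient f x i * x i := by
      rw [PiLp.inner_apply]
      simp [mul_comm]
    rw [e1, e2, lap, ← Finset.sum_add_distrib, ← Finset.sum_sub_distrib, Finset.mul_sum,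
      Finset.mul_sum]
    refine Finset.sum_congr rfl fun i _ => ?_
    ring
  · have e3 : gradient f x = ∑ i, gradient f x i • EuclideanSpace.single i (1 : ℝ) := by
      ext j
      simp [Pi.single_apply]
    have e4 : fderiv ℝ χ x (gradient f x) =
        ∑ i, gradient f x i * fderiv ℝ χ x (EuclideanSpace.single i 1) := by
      conv_lhs => rw [e3, map_sum]
      simp only [map_smul, smul_eq_mul]
    dsimp only
    rw [e4, Finset.mul_sum]
    refine Finset.sum_congr rfl fun i _ => ?_
    ring

lemma integral_norm_gradient_sq_add_integral_lap {K : ℝ≥0} (hf : ContDiff ℝ 2 f)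
    (hK : ∀ x, ‖gradient f x‖ ≤ K) {ν : Measure (EuclideanSpace ℝ (Fin n))}
    [IsProbabilityMeasure ν]
    (hν : ν = (stdGaussian n).withDensity fun x => ENNReal.ofReal (Real.exp (f x)))
    (hfish : Integrable (fun x => ‖gradient f x‖ ^ 2) ν) (hlap : Integrable (lap f) ν) :
    ∫ x, ‖gradient f x‖ ^ 2 ∂ν + ∫ x, lap f x ∂ν = ∫ x, ⟪gradient f x, x⟫ ∂ν := by
  have hg := (contDiff_gradient hf).continuous
  have hin : Integrable (fun x => ⟪gradient f x, x⟫) ν := by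
    have hn : Integrable (fun x => ‖x‖) ν := by
      rw [hν]
      exact (lipschitzWith_of_norm_gradient_le (hf.differentiable two_ne_zero)
        hK).integrable_norm_withDensity
    refine (hn.const_mul K).mono' (by fun_prop) (Filter.Eventually.of_forall fun x => ?_)
    exact (norm_inner_le_norm _ _).trans
      (mul_le_mul_of_nonneg_right (hK x) (norm_nonneg x))
  have hsum := (hlap.add hfish).sub hin
  let b : ContDiffBump (0 : EuclideanSpace ℝ (Fin n)) := ⟨1, 2, one_pos, one_lt_two⟩
  have hb : ContDiff ℝ 1 b := b.contDiff
  obtain ⟨C, hC⟩ := (hb.continuous_fderiv one_ne_zero).bounded_above_of_compact_support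
    (b.hasCompactSupport.fderiv ℝ)
  have hL : Filter.Tendsto (fun ε : ℝ => ∫ x, b (ε • x) *
      (lap f x + ‖gradient f x‖ ^ 2 - ⟪gradient f x, x⟫) ∂ν) (𝓝[>] 0)
      (𝓝 (∫ x, (lap f x + ‖gradient f x‖ ^ 2 - ⟪gradient f x, x⟫) ∂ν)) := by
    refine tendsto_integral_filter_of_dominated_convergence _
      (Filter.Eventually.of_forall fun ε => ?_) (Filter.Eventually.of_forall fun ε =>
        Filter.Eventually.of_forall fun x => ?_) hsum.norm (Filter.Eventually.of_forall fun x => ?_)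
    · exact (Continuous.aestronglyMeasurable (by fun_prop)).mul hsum.aestronglyMeasurable
    · rw [norm_mul, Real.norm_of_nonneg b.nonneg]
      exact mul_le_of_le_one_left (norm_nonneg _) b.le_one
    · have h1 : Continuous fun ε : ℝ => b (ε • x) := by fun_prop
      have h2 := (h1.tendsto 0).mono_left (nhdsWithin_le_nhds (s := Set.Ioi 0))
      have h3 : b ((0 : ℝ) • x) = 1 := by
        rw [zero_smul]
        exact b.one_of_mem_closedBall (by simp [b])
      rw [h3] at h2
      simpa using h2.mul_const (lap f x + ‖gradient f x‖ ^ 2 - ⟪gradient f x, x⟫)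
  have hR : Filter.Tendsto (fun ε : ℝ => ∫ x, b (ε • x) *
      (lap f x + ‖gradient f x‖ ^ 2 - ⟪gradient f x, x⟫) ∂ν) (𝓝[>] 0) (𝓝 0) := by
    have h0 : Filter.Tendsto (fun ε : ℝ => ε * (C * K)) (𝓝[>] 0) (𝓝 0) := by
      have : Continuous fun ε : ℝ => ε * (C * K) := by fun_prop
      simpa using (this.tendsto 0).mono_left (nhdsWithin_le_nhds (s := Set.Ioi 0))
    refine squeeze_zero_norm' ?_ h0
    filter_upwards [self_mem_nhdsWithin] with ε (hε : 0 < ε)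
    have hχ : ContDiff ℝ 1 fun x => b (ε • x) := hb.comp (contDiff_const_smul ε)
    rw [hν, integral_mul_lap_add_eq hf hχ (b.hasCompactSupport.comp_smul hε.ne'), norm_neg, ← hν]
    refine (norm_integral_le_of_norm_le_const (C := ε * (C * K))
      (Filter.Eventually.of_forall fun x => ?_)).trans_eq (by simp)
    have hd : fderiv ℝ (fun x => b (ε • x)) x = ε • fderiv ℝ b (ε • x) := by
      simpa using fderiv_comp_smul (f := b) (x := x) ε
    rw [hd, smul_apply, norm_smul, Real.norm_of_nonneg hε.le]
    gcongr
    exact ((fderiv ℝ b (ε • x)).le_opNorm _).trans (mul_le_mul (hC _) (hK x) (norm_nonneg _)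
      ((norm_nonneg _).trans (hC 0)))
  have h := tendsto_nhds_unique hL hR
  have h' : ∫ x, (lap f x + ‖gradient f x‖ ^ 2 - ⟪gradient f x, x⟫) ∂ν =
      ∫ x, lap f x ∂ν + ∫ x, ‖gradient f x‖ ^ 2 ∂ν - ∫ x, ⟪gradient f x, x⟫ ∂ν :=
    (integral_sub (hlap.add hfish) hin).trans (by rw [← integral_add hlap hfish]; rfl)
  linarith

end IntegrationByParts

theorem reverse_log_sobolev_improved (n : ℕ)
    (f : EuclideanSpace ℝ (Fin n) → ℝ) (ν : Measure (EuclideanSpace ℝ (Fin n)))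
    (hf : ContDiff ℝ 2 f)
    (hν : ν = (stdGaussian n).withDensity fun x => ENNReal.ofReal (Real.exp (f x)))
    (hprob : IsProbabilityMeasure ν)
    (hent : Integrable f ν)
    (hfish : Integrable (fun x => ‖gradient f x‖ ^ 2) ν)
    (hlap : Integrable (lap f) ν)
    (hbdd : ∀ y : EuclideanSpace ℝ (Fin n),
      BddAbove (Set.range fun t : Set.range (gradient f) =>
        ⟪y, (t : EuclideanSpace ℝ (Fin n))⟫))
    (hD : Integrable (gaussWidthFn (Set.range (gradient f))) (stdGaussian n)) :
    (1 / 2) * ∫ x, ‖gradient f x‖ ^ 2 ∂ν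
      ≤ ∫ x, f x ∂ν - (1 / 2) * ∫ x, lap f x ∂ν
        + (1 / 2) * ∫ y, gaussWidthFn (Set.range (gradient f)) y ∂(stdGaussian n) := by
  obtain ⟨R, hR⟩ := exists_norm_le_of_bddAbove_inner hbdd
  have hgrad : ∀ x, ‖gradient f x‖ ≤ R := fun x => hR _ ⟨x, rfl⟩
  have hd : Differentiable ℝ f := hf.differentiable two_ne_zero
  have h1 := integral_inner_gradient_le (lipschitzWith_of_norm_gradient_le hd hgrad)
    (hf.of_le one_le_two) (lipschitzWith_gaussWidthFn (Set.range_nonempty _) hR hbdd)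
    (sub_le_gaussWidthFn_range_gradient hd hbdd) (fun c hc y => gaussWidthFn_smul hc y) hν
  have h2 := integral_norm_gradient_sq_add_integral_lap hf hgrad hν hfish hlap
  linarith
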